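/- Let T_i : ℝⁿ → ℝⁿ be nonexpansive for all i ∈ I and assume the Markov operator 𝒫 possesses an invariant probability measure. Let μ be a probability measure on ℝⁿ and ν_k := (1/k) Σ_{j=1}^{k} μ𝒫ʲ. Then: (a) for each x ∈ Supp μ the Cesàro averages ν_k^x := (1/k) Σ_{j=1}^{k} δ_x𝒫ʲ converge in distribution to an invariant probability measure π^x; and (b) (ν_k) converges in distribution (equivalently, in the Prokhorov–Lévy metric) to an invariant probability measure π^μ satisfying π^μ(A) = ∫_{Supp μ} π^x(A) μ(dx) for every Borel set A. -/

import Mathlib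

open MeasureTheory Filter Topology

/-- The support of a measure. -/
def msupport {G : Type*} [TopologicalSpace G] [MeasurableSpace G]
    (μ : MeasureTheory.Measure G) : Set G :=
  {x | ∀ U ∈ nhds x, 0 < μ U}

/-- One application of the dual Markov operator of the RFI, with `μξ` the law of `ξ`. -/
noncomputable def markovStep {G I : Type*} [MeasurableSpace G] [MeasurableSpace I]
    (μξ : MeasureTheory.Measure I) (T : I → G → G) (μ : MeasureTheory.Measure G) :
    MeasureTheory.Measure G :=
  μ.bind fun x => μξ.map fun i => T i x

/-- The Cesàro averages `ν_k = (1/k) ∑_{j=1}^k μ𝒫ʲ` of the iterates. -/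
noncomputable def cesaro {G I : Type*} [MeasurableSpace G] [MeasurableSpace I]
    (μξ : MeasureTheory.Measure I) (T : I → G → G) (μ : MeasureTheory.Measure G) (k : ℕ) :
    MeasureTheory.Measure G :=
  (k : ENNReal)⁻¹ • ∑ j ∈ Finset.Icc 1 k, (markovStep μξ T)^[j] μ

open scoped BoundedContinuousFunction ENNReal NNReal

section MeanErgodic

variable {V : Type*} [NormedAddCommGroup V] [NormedSpace ℝ V]

/-- The Cesàro averages `(1/k) ∑_{j=1}^k P^j` of the powers of an operator. -/
noncomputable def cesaroOp (P : Module.End ℝ V) (k : ℕ) : Module.End ℝ V :=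
  (k : ℝ)⁻¹ • ∑ j ∈ Finset.Icc 1 k, P ^ j

lemma cesaroOp_apply (P : Module.End ℝ V) (k : ℕ) (v : V) :
    cesaroOp P k v = (k : ℝ)⁻¹ • ∑ j ∈ Finset.Icc 1 k, (P ^ j) v := by
  simp [cesaroOp, LinearMap.sum_apply]

lemma cesaroOp_commute (P : Module.End ℝ V) (k m : ℕ) (v : V) :
    cesaroOp P k (cesaroOp P m v) = cesaroOp P m (cesaroOp P k v) := by
  have h : Commute (cesaroOp P k) (cesaroOp P m) :=
    ((Commute.sum_left _ _ _ fun _ _ ↦ Commute.sum_right _ _ _ fun _ _ ↦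
      Commute.pow_pow_self P _ _).smul_left _).smul_right _
  exact LinearMap.congr_fun h.eq v

variable {P : Module.End ℝ V}

lemma norm_pow_apply_le (hP : ∀ v, ‖P v‖ ≤ ‖v‖) (j : ℕ) (v : V) : ‖(P ^ j) v‖ ≤ ‖v‖ := by
  induction j with
  | zero => simp
  | succ j ih => rw [pow_succ', Module.End.mul_apply]; exact (hP _).trans ih

lemma norm_cesaroOp_apply_le (hP : ∀ v, ‖P v‖ ≤ ‖v‖) (k : ℕ) (v : V) :
    ‖cesaroOp P k v‖ ≤ ‖v‖ := by
  rcases Nat.eq_zero_or_pos k with rfl | hk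
  · simp [cesaroOp]
  rw [cesaroOp_apply, norm_smul]
  have h := norm_sum_le_of_le (Finset.Icc 1 k) fun j _ ↦ norm_pow_apply_le hP j v
  rw [Finset.sum_const, Nat.card_Icc, Nat.add_sub_cancel, nsmul_eq_mul] at h
  have hk' : (0 : ℝ) < k := by exact_mod_cast hk
  rw [norm_inv, Real.norm_natCast, inv_mul_le_iff₀ hk']
  exact h

lemma cesaroOp_apply_sub (P : Module.End ℝ V) (m : ℕ) (v : V) :
    cesaroOp P m (P v) - cesaroOp P m v = (m : ℝ)⁻¹ • ((P ^ (m + 1)) v - P v) := by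
  rw [cesaroOp_apply, cesaroOp_apply, ← smul_sub]
  congr 1
  induction m with
  | zero => simp
  | succ m ih =>
    rw [Finset.sum_Icc_succ_top (by omega), Finset.sum_Icc_succ_top (by omega),
      add_sub_add_comm, ih, ← Module.End.mul_apply, ← pow_succ]
    abel

lemma tendsto_cesaroOp_apply_sub (hP : ∀ v, ‖P v‖ ≤ ‖v‖) (v : V) :
    Tendsto (fun m ↦ cesaroOp P m (P v) - cesaroOp P m v) atTop (𝓝 0) := by
  have h : Tendsto (fun m : ℕ ↦ (m : ℝ)⁻¹ * (‖v‖ + ‖v‖)) atTop (𝓝 0) := by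
    simpa using tendsto_inv_atTop_nhds_zero_nat.mul_const (‖v‖ + ‖v‖)
  refine squeeze_zero_norm (fun m ↦ ?_) h
  rw [cesaroOp_apply_sub, norm_smul, norm_inv, Real.norm_natCast]
  gcongr
  exact (norm_sub_le _ _).trans (add_le_add (norm_pow_apply_le hP _ v) (hP v))

lemma tendsto_cesaroOp_pow_apply_sub (hP : ∀ v, ‖P v‖ ≤ ‖v‖) (j : ℕ) (v : V) :
    Tendsto (fun m ↦ cesaroOp P m ((P ^ j) v) - cesaroOp P m v) atTop (𝓝 0) := by
  induction j with
  | zero => simp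
  | succ j ih =>
    have h := (tendsto_cesaroOp_apply_sub hP ((P ^ j) v)).add ih
    simpa [pow_succ'] using h

lemma tendsto_cesaroOp_cesaroOp_sub (hP : ∀ v, ‖P v‖ ≤ ‖v‖) {k : ℕ} (hk : k ≠ 0) (v : V) :
    Tendsto (fun m ↦ cesaroOp P m (cesaroOp P k v) - cesaroOp P m v) atTop (𝓝 0) := by
  have h := (tendsto_finsetSum (Finset.Icc 1 k) fun j _ ↦
    tendsto_cesaroOp_pow_apply_sub hP j v).const_smul (k : ℝ)⁻¹
  have hk' : (k : ℝ) ≠ 0 := by exact_mod_cast hk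
  simp only [Finset.sum_const_zero, smul_zero] at h
  refine h.congr fun m ↦ ?_
  rw [Finset.sum_sub_distrib, Finset.sum_const, Nat.card_Icc, Nat.add_sub_cancel, smul_sub,
    ← Nat.cast_smul_eq_nsmul ℝ, inv_smul_smul₀ hk', cesaroOp_apply P k v, map_smul, map_sum]

end MeanErgodic

section Metric

variable {E : Type*} [PseudoMetricSpace E] [MeasurableSpace E] [BorelSpace E]

lemma integral_le_integral_add_of_levyProkhorovEDist_lt {μ ν : Measure E}
    [IsProbabilityMeasure μ] [IsProbabilityMeasure ν] {ε : ℝ} (hε : 0 < ε)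
    (hμν : levyProkhorovEDist μ ν < ENNReal.ofReal ε) {f : E →ᵇ ℝ} {L : ℝ≥0}
    (hf : LipschitzWith L f) (hf0 : 0 ≤ f) :
    ∫ x, f x ∂μ ≤ ∫ x, f x ∂ν + ε * (L + ‖f‖) := by
  set g : E →ᵇ ℝ := f + BoundedContinuousFunction.const E (L * ε) with hg
  have hgf (x : E) : g x = f x + L * ε := rfl
  have hLε : 0 ≤ L * ε := by positivity
  have hg0 (x : E) : 0 ≤ g x := by rw [hgf]; exact add_nonneg (hf0 x) hLε
  have hfg : ‖f‖ ≤ ‖g‖ := by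
    refine (BoundedContinuousFunction.norm_le (norm_nonneg _)).2 fun x ↦ ?_
    refine le_trans ?_ (g.norm_coe_le_norm x)
    rw [Real.norm_of_nonneg (show 0 ≤ f x from hf0 x), Real.norm_of_nonneg (hg0 x), hgf]
    linarith
  have hinteg (a : ℝ) : IntegrableOn (fun t ↦ ν.real {x | t ≤ g x}) (Set.Ioc 0 a) := by
    refine Measure.integrableOn_of_bounded (M := 1) measure_Ioc_lt_top.ne ?_ ?_
    · refine (Measurable.ennreal_toReal (Antitone.measurable ?_)).aestronglyMeasurable
      exact fun _ _ hst ↦ measure_mono fun _ h ↦ hst.trans h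
    · refine ae_of_all _ fun t ↦ ?_
      rw [Real.norm_of_nonneg measureReal_nonneg]
      exact measureReal_le_one
  have h1 := BoundedContinuousFunction.integral_le_of_levyProkhorovEDist_lt μ ν hε hμν f
    (ae_of_all _ hf0)
  have h2 : ∫ t in Set.Ioc 0 ‖f‖, ν.real (Metric.thickening ε {a | t ≤ f a})
      ≤ ∫ t in Set.Ioc 0 ‖f‖, ν.real {x | t ≤ g x} := by
    refine integral_mono_of_nonneg (ae_of_all _ fun _ ↦ measureReal_nonneg) (hinteg _)
      (ae_of_all _ fun t ↦ measureReal_mono ?_)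
    intro x hx
    obtain ⟨a, ha, hxa⟩ := Metric.mem_thickening_iff.1 hx
    have h3 := hf.dist_le_mul a x
    have h4 : (L : ℝ) * dist a x ≤ L * ε := by
      rw [dist_comm]; gcongr
    have h5 := le_abs_self (f a - f x)
    rw [Real.dist_eq] at h3
    simp only [Set.mem_ofPred_eq] at ha ⊢
    rw [hgf]
    linarith
  have h3 : ∫ t in Set.Ioc 0 ‖f‖, ν.real {x | t ≤ g x}
      ≤ ∫ t in Set.Ioc 0 ‖g‖, ν.real {x | t ≤ g x} :=
    setIntegral_mono_set (hinteg _) (ae_of_all _ fun _ ↦ measureReal_nonneg)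
      (Set.Ioc_subset_Ioc_right hfg).eventuallyLE
  rw [← BoundedContinuousFunction.integral_eq_integral_meas_le g ν (ae_of_all _ hg0)] at h3
  have h4 : ∫ x, g x ∂ν = ∫ x, f x ∂ν + L * ε := by
    simp_rw [hgf]
    rw [integral_add (f.integrable ν) (integrable_const _)]
    simp
  linarith

/-- Convergence in distribution is uniform over uniformly bounded families of functions with a
common Lipschitz constant. -/
lemma ProbabilityMeasure.eventually_abs_integral_sub_le [SecondCountableTopology E] {ι : Type*}
    {l : Filter ι} {ν : ι → ProbabilityMeasure E} {π : ProbabilityMeasure E}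
    (h : Tendsto ν l (𝓝 π)) (L : ℝ≥0) (C : ℝ) {ε : ℝ} (hε : 0 < ε) :
    ∀ᶠ i in l, ∀ f : E →ᵇ ℝ, LipschitzWith L f → ‖f‖ ≤ C →
      |∫ x, f x ∂(ν i : Measure E) - ∫ x, f x ∂(π : Measure E)| ≤ ε := by
  set D : ℝ := L + 2 * |C| + 1 with hD
  have hD0 : 0 < D := by positivity
  have hδ : 0 < ε / D := by positivity
  have h' := ((LevyProkhorov.probabilityMeasureHomeomorph (Ω := E)).continuous.tendsto π).comp h
  filter_upwards [Metric.tendsto_nhds.1 h' _ hδ] with i hi f hf hfC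
  have hi' : levyProkhorovEDist (ν i : Measure E) (π : Measure E) < ENNReal.ofReal (ε / D) := by
    rw [← edist_lt_ofReal] at hi
    exact hi
  set g : E →ᵇ ℝ := f + BoundedContinuousFunction.const E |C| with hg
  have hgf (x : E) : g x = f x + |C| := rfl
  have hg0 : 0 ≤ g := fun x ↦ by
    have := neg_le_of_abs_le ((f.norm_coe_le_norm x).trans (hfC.trans (le_abs_self C)))
    change 0 ≤ f x + |C|
    linarith
  have hgL : LipschitzWith L g := by
    refine LipschitzWith.of_dist_le_mul fun x y ↦ ?_
    rw [hgf, hgf, dist_add_right]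
    exact hf.dist_le_mul x y
  have hgC : ‖g‖ ≤ 2 * |C| := by
    refine (BoundedContinuousFunction.norm_le (by positivity)).2 fun x ↦ ?_
    have := le_of_abs_le ((f.norm_coe_le_norm x).trans (hfC.trans (le_abs_self C)))
    rw [Real.norm_of_nonneg (show 0 ≤ g x from hg0 x), hgf]
    linarith
  have hbound : ε / D * (L + ‖g‖) ≤ ε := by
    rw [div_mul_eq_mul_div, div_le_iff₀ hD0]
    gcongr
    linarith
  have hinteg (ρ : Measure E) [IsProbabilityMeasure ρ] : ∫ x, g x ∂ρ = ∫ x, f x ∂ρ + |C| := by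
    simp_rw [hgf]
    rw [integral_add (f.integrable ρ) (integrable_const _)]
    simp
  have h1 := integral_le_integral_add_of_levyProkhorovEDist_lt hδ hi' hgL hg0
  rw [levyProkhorovEDist_comm] at hi'
  have h2 := integral_le_integral_add_of_levyProkhorovEDist_lt hδ hi' hgL hg0
  rw [hinteg, hinteg] at h1 h2
  rw [abs_sub_le_iff]
  constructor <;> linarith

/-- A family of probability measures depending measurably on a parameter when tested against
bounded continuous functions is measurable. -/
lemma measurable_of_forall_measurable_integral {α : Type*} [MeasurableSpace α]
    {κ : α → Measure E} (hκ : ∀ a, IsProbabilityMeasure (κ a))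
    (h : ∀ f : E →ᵇ ℝ, Measurable fun a ↦ ∫ x, f x ∂(κ a)) : Measurable κ := by
  refine Measurable.measure_of_isPiSystem_of_isProbabilityMeasure
    (BorelSpace.measurable_eq.trans borel_eq_generateFrom_isClosed) isPiSystem_isClosed
    fun F hF ↦ ?_
  have hreal : Measurable fun a ↦ (κ a).real F := by
    refine measurable_of_tendsto_metrizable (f := fun (n : ℕ) a ↦
      ∫ x, (thickenedIndicator (Nat.one_div_pos_of_nat (α := ℝ) (n := n)) F x : ℝ) ∂(κ a))
      (fun n ↦ ?_) (tendsto_pi_nhds.2 fun a ↦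
        tendsto_integral_thickenedIndicator_of_isClosed (κ a) hF
          (fun n ↦ Nat.one_div_pos_of_nat) tendsto_one_div_add_atTop_nhds_zero_nat)
    exact h (BoundedContinuousFunction.comp _ NNReal.isometry_coe.lipschitz
      (thickenedIndicator (Nat.one_div_pos_of_nat (α := ℝ) (n := n)) F))
  have hF' : (fun a ↦ κ a F) = fun a ↦ ENNReal.ofReal ((κ a).real F) :=
    funext fun a ↦ (ofReal_measureReal (μ := κ a) (s := F)).symm
  rw [hF']
  exact hreal.ennreal_ofReal

lemma integral_bind_of_measurable {α : Type*} [MeasurableSpace α] (μ : Measure α)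
    [IsProbabilityMeasure μ] {κ : α → Measure E} (hκ : Measurable κ)
    (hκ' : ∀ a, IsProbabilityMeasure (κ a)) (f : E →ᵇ ℝ) :
    ∫ x, f x ∂(μ.bind κ) = ∫ a, ∫ x, f x ∂(κ a) ∂μ := by
  let K : ProbabilityTheory.Kernel α E := ⟨κ, hκ⟩
  have : ProbabilityTheory.IsMarkovKernel K := ⟨hκ'⟩
  change ∫ x, f x ∂(μ.bind K) = ∫ a, ∫ x, f x ∂(K a) ∂μ
  rw [Measure.comp_eq_comp_const_apply, ProbabilityTheory.Kernel.integral_comp (f.integrable _)]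
  simp

end Metric

section CesaroEvaluation

variable {E : Type*} [TopologicalSpace E]

lemma cesaroOp_coe_apply (P : Module.End ℝ (E →ᵇ ℝ)) (k : ℕ) (f : E →ᵇ ℝ) (x : E) :
    cesaroOp P k f x = (k : ℝ)⁻¹ * ∑ j ∈ Finset.Icc 1 k, (P ^ j) f x := by
  rw [cesaroOp_apply, BoundedContinuousFunction.smul_apply, smul_eq_mul,
    BoundedContinuousFunction.coe_sum, Finset.sum_apply]

lemma cesaroOp_le_of_forall_pow_le {P : Module.End ℝ (E →ᵇ ℝ)} {f : E →ᵇ ℝ} {x : E} {C : ℝ}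
    (hC : 0 ≤ C) (h : ∀ j, (P ^ j) f x ≤ C) (k : ℕ) : cesaroOp P k f x ≤ C := by
  rcases Nat.eq_zero_or_pos k with rfl | hk
  · simpa [cesaroOp_coe_apply] using hC
  have hk' : (0 : ℝ) < k := by exact_mod_cast hk
  rw [cesaroOp_coe_apply, inv_mul_le_iff₀ hk']
  simpa using Finset.sum_le_card_nsmul (Finset.Icc 1 k) _ C fun j _ ↦ h j

end CesaroEvaluation

lemma msupport_eq_support {G : Type*} [TopologicalSpace G] [MeasurableSpace G] (μ : Measure G) :
    msupport μ = μ.support := by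
  ext x
  exact (Measure.mem_support_iff_forall x).symm

lemma isProbabilityMeasure_bind {α β : Type*} [MeasurableSpace α] [MeasurableSpace β]
    (ν : Measure α) [IsProbabilityMeasure ν] {κ : α → Measure β} (hκ : Measurable κ)
    (hκ' : ∀ a, IsProbabilityMeasure (κ a)) : IsProbabilityMeasure (ν.bind κ) :=
  ⟨by rw [Measure.bind_apply .univ hκ.aemeasurable]; simp⟩

section StepKernel

variable {E I : Type*} [MeasurableSpace E] [MeasurableSpace I] {T : I → E → E} {μξ : Measure I}
  [IsProbabilityMeasure μξ]

lemma measurable_map_apply (hΦ : Measurable fun p : E × I ↦ T p.2 p.1) :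
    Measurable fun x ↦ μξ.map fun i ↦ T i x := by
  refine Measure.measurable_of_measurable_coe _ fun s hs ↦ ?_
  have h (x : E) : (μξ.map fun i ↦ T i x) s = μξ (Prod.mk x ⁻¹' ((fun p ↦ T p.2 p.1) ⁻¹' s)) :=
    Measure.map_apply (hΦ.comp measurable_prodMk_left) hs
  simp_rw [h]
  exact measurable_measure_prodMk_left (hΦ hs)

lemma isProbabilityMeasure_map_apply (hΦ : Measurable fun p : E × I ↦ T p.2 p.1) (x : E) :
    IsProbabilityMeasure (μξ.map fun i ↦ T i x) :=
  Measure.isProbabilityMeasure_map (hΦ.comp measurable_prodMk_left).aemeasurable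

lemma isProbabilityMeasure_markovStep (hΦ : Measurable fun p : E × I ↦ T p.2 p.1)
    (ν : Measure E) [IsProbabilityMeasure ν] : IsProbabilityMeasure (markovStep μξ T ν) :=
  isProbabilityMeasure_bind ν (measurable_map_apply hΦ) (isProbabilityMeasure_map_apply hΦ)

lemma isProbabilityMeasure_iterate_markovStep (hΦ : Measurable fun p : E × I ↦ T p.2 p.1)
    (ν : Measure E) [IsProbabilityMeasure ν] (j : ℕ) :
    IsProbabilityMeasure ((markovStep μξ T)^[j] ν) := by
  induction j with
  | zero => simpa
  | succ j ih =>
    rw [Function.iterate_succ_apply']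
    exact isProbabilityMeasure_markovStep hΦ _

lemma isProbabilityMeasure_cesaro (hΦ : Measurable fun p : E × I ↦ T p.2 p.1)
    (ν : Measure E) [IsProbabilityMeasure ν] {k : ℕ} (hk : k ≠ 0) :
    IsProbabilityMeasure (cesaro μξ T ν k) := by
  have (j : ℕ) := isProbabilityMeasure_iterate_markovStep (μξ := μξ) hΦ ν j
  refine ⟨?_⟩
  simp only [cesaro, Measure.smul_apply, Measure.finsetSum_apply, measure_univ, smul_eq_mul,
    Finset.sum_const, Nat.card_Icc, Nat.add_sub_cancel, nsmul_eq_mul, mul_one]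
  exact ENNReal.inv_mul_cancel (by exact_mod_cast hk) (ENNReal.natCast_ne_top k)

end StepKernel

section MarkovOperator

variable {E I : Type*} [NormedAddCommGroup E] [MeasurableSpace E] [BorelSpace E]
  [MeasurableSpace I] {T : I → E → E} {μξ : Measure I} [IsProbabilityMeasure μξ]

lemma integrable_comp_apply (hΦ : Measurable fun p : E × I ↦ T p.2 p.1) (f : E →ᵇ ℝ) (x : E) :
    Integrable (fun i ↦ f (T i x)) μξ :=
  Integrable.of_bound
    (f.continuous.measurable.comp (hΦ.comp measurable_prodMk_left)).aestronglyMeasurable ‖f‖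
    (ae_of_all _ fun _ ↦ f.norm_coe_le_norm _)

/-- The Markov operator of the RFI acting on bounded continuous functions. -/
noncomputable def markovOp (hT : ∀ i, LipschitzWith 1 (T i))
    (hΦ : Measurable fun p : E × I ↦ T p.2 p.1) (μξ : Measure I) [IsProbabilityMeasure μξ] :
    Module.End ℝ (E →ᵇ ℝ) where
  toFun f := BoundedContinuousFunction.ofNormedAddCommGroup (fun x ↦ ∫ i, f (T i x) ∂μξ)
    (continuous_of_dominated (fun x ↦ (integrable_comp_apply hΦ f x).aestronglyMeasurable)
      (fun _ ↦ ae_of_all _ fun _ ↦ f.norm_coe_le_norm _) (integrable_const ‖f‖)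
      (ae_of_all _ fun i ↦ f.continuous.comp (hT i).continuous))
    ‖f‖ fun x ↦ by
      simpa using norm_integral_le_of_norm_le_const (μ := μξ) (f := fun i ↦ f (T i x))
        (ae_of_all _ fun i ↦ f.norm_coe_le_norm _)
  map_add' f g := by
    ext x
    exact integral_add (integrable_comp_apply hΦ f x) (integrable_comp_apply hΦ g x)
  map_smul' c f := by
    ext x
    exact integral_const_mul c fun i ↦ f (T i x)

variable {hT : ∀ i, LipschitzWith 1 (T i)} {hΦ : Measurable fun p : E × I ↦ T p.2 p.1}

lemma markovOp_apply (f : E →ᵇ ℝ) (x : E) : markovOp hT hΦ μξ f x = ∫ i, f (T i x) ∂μξ := rfl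

lemma norm_markovOp_apply_le (f : E →ᵇ ℝ) : ‖markovOp hT hΦ μξ f‖ ≤ ‖f‖ :=
  (BoundedContinuousFunction.norm_le (norm_nonneg f)).2 fun x ↦ by
    simpa using! norm_integral_le_of_norm_le_const (μ := μξ) (f := fun i ↦ f (T i x))
      (ae_of_all _ fun i ↦ f.norm_coe_le_norm _)

lemma lipschitzWith_markovOp {f : E →ᵇ ℝ} {L : ℝ≥0} (hf : LipschitzWith L f) :
    LipschitzWith L (markovOp hT hΦ μξ f) := by
  refine LipschitzWith.of_dist_le_mul fun x y ↦ ?_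
  rw [dist_eq_norm, markovOp_apply, markovOp_apply,
    ← integral_sub (integrable_comp_apply hΦ f x) (integrable_comp_apply hΦ f y)]
  have h := norm_integral_le_of_norm_le_const (μ := μξ) (f := fun i ↦ f (T i x) - f (T i y))
    (C := L * dist x y) (ae_of_all _ fun i ↦ by
      rw [← dist_eq_norm]
      refine (hf.dist_le_mul _ _).trans ?_
      gcongr
      simpa using (hT i).dist_le_mul x y)
  simpa using h

lemma lipschitzWith_markovOp_pow {f : E →ᵇ ℝ} {L : ℝ≥0} (hf : LipschitzWith L f) (j : ℕ) :
    LipschitzWith L ((markovOp hT hΦ μξ ^ j) f) := by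
  induction j with
  | zero => simpa using hf
  | succ j ih => rw [pow_succ', Module.End.mul_apply]; exact lipschitzWith_markovOp ih

lemma lipschitzWith_cesaroOp {f : E →ᵇ ℝ} {L : ℝ≥0} (hf : LipschitzWith L f) (k : ℕ) :
    LipschitzWith L (cesaroOp (markovOp hT hΦ μξ) k f) := by
  refine LipschitzWith.of_dist_le_mul fun x y ↦ ?_
  rcases Nat.eq_zero_or_pos k with rfl | hk
  · simp only [cesaroOp_coe_apply, CharP.cast_eq_zero, inv_zero, zero_mul, dist_self]
    positivity
  have hk' : (0 : ℝ) < k := by exact_mod_cast hk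
  rw [dist_eq_norm, cesaroOp_coe_apply, cesaroOp_coe_apply, ← mul_sub, norm_mul, norm_inv,
    Real.norm_natCast, inv_mul_le_iff₀ hk', ← Finset.sum_sub_distrib]
  have h := norm_sum_le_of_le (Finset.Icc 1 k)
    (f := fun j ↦ (markovOp hT hΦ μξ ^ j) f x - (markovOp hT hΦ μξ ^ j) f y)
    fun j _ ↦ (dist_eq_norm _ _).symm.trans_le ((lipschitzWith_markovOp_pow hf j).dist_le_mul x y)
  rwa [Finset.sum_const, Nat.card_Icc, Nat.add_sub_cancel, nsmul_eq_mul] at h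

/-- Synchronous coupling of two nonexpansive trajectories. -/
lemma markovOp_pow_apply_le {f g : E →ᵇ ℝ} {R : ℝ} (hfg : ∀ a b, dist a b ≤ R → f a ≤ g b)
    (j : ℕ) {x y : E} (hxy : dist x y ≤ R) :
    (markovOp hT hΦ μξ ^ j) f x ≤ (markovOp hT hΦ μξ ^ j) g y := by
  induction j generalizing x y with
  | zero => simpa using hfg x y hxy
  | succ j ih =>
    rw [pow_succ', Module.End.mul_apply, Module.End.mul_apply, markovOp_apply, markovOp_apply]
    refine integral_mono (integrable_comp_apply hΦ _ x) (integrable_comp_apply hΦ _ y) fun i ↦ ?_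
    exact ih (((hT i).dist_le_mul x y).trans (by simpa using hxy))

variable (hT hΦ)

lemma integral_markovStep (ν : Measure E) [IsProbabilityMeasure ν] (f : E →ᵇ ℝ) :
    ∫ x, f x ∂(markovStep μξ T ν) = ∫ x, markovOp hT hΦ μξ f x ∂ν := by
  rw [markovStep, integral_bind_of_measurable ν (measurable_map_apply hΦ)
    (isProbabilityMeasure_map_apply hΦ)]
  refine integral_congr_ae (ae_of_all _ fun x ↦ ?_)
  exact integral_map (hΦ.comp measurable_prodMk_left).aemeasurable
    f.continuous.measurable.aestronglyMeasurable

lemma integral_iterate_markovStep (ν : Measure E) [IsProbabilityMeasure ν] (j : ℕ) (f : E →ᵇ ℝ) :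
    ∫ x, f x ∂((markovStep μξ T)^[j] ν) = ∫ x, (markovOp hT hΦ μξ ^ j) f x ∂ν := by
  induction j generalizing f with
  | zero => simp
  | succ j ih =>
    have := isProbabilityMeasure_iterate_markovStep (μξ := μξ) hΦ ν j
    rw [Function.iterate_succ_apply', integral_markovStep hT hΦ, ih, pow_succ,
      Module.End.mul_apply]

lemma integral_cesaro (ν : Measure E) [IsProbabilityMeasure ν] (k : ℕ) (f : E →ᵇ ℝ) :
    ∫ x, f x ∂(cesaro μξ T ν k) = ∫ x, cesaroOp (markovOp hT hΦ μξ) k f x ∂ν := by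
  have (j : ℕ) := isProbabilityMeasure_iterate_markovStep (μξ := μξ) hΦ ν j
  simp_rw [cesaroOp_coe_apply]
  rw [cesaro, integral_smul_measure, integral_finsetSum_measure fun j _ ↦ f.integrable _,
    integral_const_mul, integral_finsetSum _ fun j _ ↦ BoundedContinuousFunction.integrable _ _]
  simp [integral_iterate_markovStep hT hΦ]

lemma integral_cesaro_dirac (x : E) (k : ℕ) (f : E →ᵇ ℝ) :
    ∫ y, f y ∂(cesaro μξ T (Measure.dirac x) k) = cesaroOp (markovOp hT hΦ μξ) k f x := by
  rw [integral_cesaro hT hΦ, integral_dirac]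

lemma integral_markovOp_pow_of_invariant {π : Measure E} [IsProbabilityMeasure π]
    (hπ : markovStep μξ T π = π) (j : ℕ) (f : E →ᵇ ℝ) :
    ∫ x, (markovOp hT hΦ μξ ^ j) f x ∂π = ∫ x, f x ∂π := by
  rw [← integral_iterate_markovStep hT hΦ, Function.iterate_fixed hπ]

lemma integral_cesaroOp_of_invariant {π : Measure E} [IsProbabilityMeasure π]
    (hπ : markovStep μξ T π = π) {k : ℕ} (hk : k ≠ 0) (f : E →ᵇ ℝ) :
    ∫ x, cesaroOp (markovOp hT hΦ μξ) k f x ∂π = ∫ x, f x ∂π := by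
  have hk' : (k : ℝ) ≠ 0 := by exact_mod_cast hk
  simp_rw [cesaroOp_coe_apply]
  rw [integral_const_mul, integral_finsetSum _ fun j _ ↦ BoundedContinuousFunction.integrable _ _]
  simp [integral_markovOp_pow_of_invariant hT hΦ hπ, hk']

/-- A bounded continuous function vanishing for `‖a‖ ≤ R` and equal to one for `R + 1 ≤ ‖a‖`. -/
noncomputable def normCutoff (R : ℝ) : E →ᵇ ℝ :=
  BoundedContinuousFunction.ofNormedAddCommGroup (fun a : E ↦ min 1 (max 0 (‖a‖ - R)))
    (by fun_prop) 1 fun a ↦ by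
      rw [Real.norm_of_nonneg (by positivity)]
      exact min_le_left _ _

omit [MeasurableSpace E] [BorelSpace E] in
lemma normCutoff_apply (R : ℝ) (a : E) : normCutoff R a = min 1 (max 0 (‖a‖ - R)) := rfl

omit [MeasurableSpace E] [BorelSpace E] in
lemma normCutoff_le_indicator (R : ℝ) (a : E) :
    normCutoff R a ≤ (Metric.closedBall 0 R)ᶜ.indicator 1 a := by
  rw [normCutoff_apply]
  by_cases ha : a ∈ (Metric.closedBall 0 R)ᶜ
  · rw [Set.indicator_of_mem ha]
    exact min_le_left _ _
  · rw [Set.indicator_of_notMem ha]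
    have : ‖a‖ ≤ R := by simpa using ha
    refine (min_le_right _ _).trans (max_le le_rfl (by linarith))

omit [MeasurableSpace E] [BorelSpace E] in
lemma indicator_le_normCutoff (R : ℝ) (a : E) :
    (Metric.closedBall 0 (R + 1))ᶜ.indicator 1 a ≤ normCutoff R a := by
  rw [normCutoff_apply]
  by_cases ha : a ∈ (Metric.closedBall 0 (R + 1))ᶜ
  · rw [Set.indicator_of_mem ha]
    have : R + 1 < ‖a‖ := by simpa using ha
    exact le_min le_rfl (le_max_of_le_right (by simp; linarith))
  · rw [Set.indicator_of_notMem ha]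
    positivity

lemma cesaroOp_normCutoff_le {π : Measure E} [IsProbabilityMeasure π]
    (hπ : markovStep μξ T π = π) (x : E) (R : ℝ) (k : ℕ) :
    cesaroOp (markovOp hT hΦ μξ) k (normCutoff (2 * R)) x
      ≤ π.real (Metric.closedBall 0 R)ᶜ + π.real (Metric.closedBall x R)ᶜ := by
  refine cesaroOp_le_of_forall_pow_le (by positivity) (fun j ↦ ?_) k
  have hcut (a b : E) (h : dist a b ≤ R) : normCutoff (2 * R) a ≤ normCutoff R b := by
    rw [normCutoff_apply, normCutoff_apply]
    have h1 : ‖a‖ - ‖b‖ ≤ dist a b := by rw [dist_eq_norm]; exact norm_sub_norm_le a b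
    gcongr 1
    exact max_le_max le_rfl (by linarith)
  set S : Set E := (Metric.closedBall x R)ᶜ
  have hS : MeasurableSet S := Metric.isClosed_closedBall.measurableSet.compl
  have hS0 : MeasurableSet (Metric.closedBall (0 : E) R)ᶜ :=
    Metric.isClosed_closedBall.measurableSet.compl
  have hle (y : E) : (markovOp hT hΦ μξ ^ j) (normCutoff (2 * R)) x
      ≤ (markovOp hT hΦ μξ ^ j) (normCutoff R) y + S.indicator 1 y := by
    have hnn : 0 ≤ (markovOp hT hΦ μξ ^ j) (normCutoff R) y := by
      have := markovOp_pow_apply_le (hT := hT) (hΦ := hΦ) (μξ := μξ) (f := 0) (g := normCutoff R)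
        (R := 0) (fun a b _ ↦ by rw [normCutoff_apply]; simp) j (dist_self y).le
      simpa using this
    by_cases hy : y ∈ S
    · rw [Set.indicator_of_mem hy]
      have h1 := ((markovOp hT hΦ μξ ^ j) (normCutoff (2 * R))).norm_coe_le_norm x
      have h2 := norm_pow_apply_le (fun f ↦ norm_markovOp_apply_le (hT := hT) (hΦ := hΦ)
        (μξ := μξ) f) j (normCutoff (E := E) (2 * R))
      have h3 : ‖normCutoff (E := E) (2 * R)‖ ≤ 1 :=
        BoundedContinuousFunction.norm_ofNormedAddCommGroup_le _ zero_le_one _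
      have h4 := (le_abs_self _).trans (h1.trans (h2.trans h3))
      simp only [Pi.one_apply]
      linarith
    · rw [Set.indicator_of_notMem hy, add_zero]
      refine markovOp_pow_apply_le hcut j ?_
      rw [dist_comm]
      simpa [S] using hy
  have hinteg : Integrable (S.indicator (1 : E → ℝ)) π := (integrable_const (1 : ℝ)).indicator hS
  have hinteg0 : Integrable ((Metric.closedBall (0 : E) R)ᶜ.indicator (1 : E → ℝ)) π :=
    (integrable_const (1 : ℝ)).indicator hS0
  have h := integral_mono (μ := π) (integrable_const _)
    ((BoundedContinuousFunction.integrable π _).add hinteg) hle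
  have h' := integral_mono (μ := π) ((normCutoff R).integrable π) hinteg0 (normCutoff_le_indicator R)
  simp only [Pi.add_apply] at h
  rw [integral_add (BoundedContinuousFunction.integrable π _) hinteg,
    integral_markovOp_pow_of_invariant hT hΦ hπ, integral_indicator_one hS] at h
  rw [integral_indicator_one hS0] at h'
  simp only [integral_const, probReal_univ, one_smul] at h
  linarith

variable [ProperSpace E]

lemma isTightMeasureSet_cesaro_dirac (hT : ∀ i, LipschitzWith 1 (T i))
    (hΦ : Measurable fun p : E × I ↦ T p.2 p.1) {π : Measure E} [IsProbabilityMeasure π]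
    (hπ : markovStep μξ T π = π) (x : E) :
    IsTightMeasureSet (Set.range fun k ↦ cesaro μξ T (Measure.dirac x) (k + 1)) := by
  rw [isTightMeasureSet_iff_exists_isCompact_measure_compl_le]
  intro ε hε
  obtain ⟨K, hK, hKπ⟩ := isTightMeasureSet_iff_exists_isCompact_measure_compl_le.1
    (isTightMeasureSet_singleton (μ := π)) (ε / 2) (ENNReal.half_pos hε.ne')
  have hKπ := hKπ π rfl
  obtain ⟨r, hr⟩ := hK.isBounded.subset_closedBall 0
  obtain ⟨s, hs⟩ := hK.isBounded.subset_closedBall x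
  set R := max r s
  have h0 : π (Metric.closedBall 0 R)ᶜ ≤ ε / 2 := (measure_mono (Set.compl_subset_compl.2
    (hr.trans (Metric.closedBall_subset_closedBall (le_max_left _ _))))).trans hKπ
  have hx : π (Metric.closedBall x R)ᶜ ≤ ε / 2 := (measure_mono (Set.compl_subset_compl.2
    (hs.trans (Metric.closedBall_subset_closedBall (le_max_right _ _))))).trans hKπ
  refine ⟨Metric.closedBall 0 (2 * R + 1), isCompact_closedBall _ _, ?_⟩
  rintro _ ⟨k, rfl⟩
  have := isProbabilityMeasure_cesaro (μξ := μξ) hΦ (Measure.dirac x) k.succ_ne_zero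
  have hmeas : MeasurableSet (Metric.closedBall (0 : E) (2 * R + 1))ᶜ :=
    Metric.isClosed_closedBall.measurableSet.compl
  have h := integral_mono (μ := cesaro μξ T (Measure.dirac x) (k + 1))
    ((integrable_const (1 : ℝ)).indicator hmeas) ((normCutoff (2 * R)).integrable _)
    (indicator_le_normCutoff (2 * R))
  rw [integral_cesaro_dirac hT hΦ] at h
  have h := h.trans (cesaroOp_normCutoff_le hT hΦ hπ x R (k + 1))
  rw [show (fun _ : E ↦ (1 : ℝ)) = 1 from rfl, integral_indicator_one hmeas] at h
  have h := ENNReal.ofReal_le_ofReal h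
  rw [ENNReal.ofReal_add measureReal_nonneg measureReal_nonneg, ofReal_measureReal,
    ofReal_measureReal, ofReal_measureReal] at h
  exact h.trans ((add_le_add h0 hx).trans_eq (ENNReal.add_halves ε))

/-- The Cesàro averages started at a point converge in distribution to an invariant measure. -/
lemma exists_invariant_tendsto_cesaroOp {ρ : Measure E} [IsProbabilityMeasure ρ]
    (hρ : markovStep μξ T ρ = ρ) (x : E) :
    ∃ π : Measure E, IsProbabilityMeasure π ∧ markovStep μξ T π = π ∧
      ∀ f : E →ᵇ ℝ, Tendsto (fun k ↦ cesaroOp (markovOp hT hΦ μξ) k f x) atTop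
        (𝓝 (∫ y, f y ∂π)) := by
  set P := markovOp hT hΦ μξ with hP
  have hPn (f : E →ᵇ ℝ) : ‖P f‖ ≤ ‖f‖ := norm_markovOp_apply_le f
  let ν (k : ℕ) : ProbabilityMeasure E := ⟨cesaro μξ T (Measure.dirac x) (k + 1),
    isProbabilityMeasure_cesaro hΦ (Measure.dirac x) k.succ_ne_zero⟩
  have hν (k : ℕ) (f : E →ᵇ ℝ) : ∫ y, f y ∂(ν k : Measure E) = cesaroOp P (k + 1) f x :=
    integral_cesaro_dirac hT hΦ x (k + 1) f
  have hcomp : IsCompact (closure (Set.range ν)) := by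
    refine isCompact_closure_of_isTightMeasureSet ?_
    refine (isTightMeasureSet_cesaro_dirac hT hΦ hρ x).subset ?_
    rintro _ ⟨_, ⟨k, rfl⟩, rfl⟩
    exact ⟨k, rfl⟩
  obtain ⟨π, -, φ, hφ, hπ⟩ :=
    hcomp.isSeqCompact fun k ↦ subset_closure (Set.mem_range_self (f := ν) k)
  have hφ' : Tendsto (fun k ↦ φ k + 1) atTop atTop :=
    tendsto_atTop_mono (fun k ↦ Nat.le_succ (φ k)) hφ.tendsto_atTop
  have heval {u : ℕ → E →ᵇ ℝ} (hu : Tendsto u atTop (𝓝 0)) :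
      Tendsto (fun k ↦ u k x) atTop (𝓝 0) :=
    squeeze_zero_norm (fun k ↦ (u k).norm_coe_le_norm x) (tendsto_zero_iff_norm_tendsto_zero.1 hu)
  have hlim (f : E →ᵇ ℝ) : Tendsto (fun k ↦ cesaroOp P (φ k + 1) f x) atTop
      (𝓝 (∫ y, f y ∂(π : Measure E))) := by
    simpa only [Function.comp_apply, hν] using
      ProbabilityMeasure.tendsto_iff_forall_integral_tendsto.1 hπ f
  have hinv : markovStep μξ T (π : Measure E) = π := by
    have := isProbabilityMeasure_markovStep (μξ := μξ) hΦ (π : Measure E)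
    refine ext_of_forall_integral_eq_of_IsFiniteMeasure fun f ↦ ?_
    rw [integral_markovStep hT hΦ]
    have h1 := (heval (tendsto_cesaroOp_apply_sub hPn f)).comp hφ'
    have h2 := (hlim (P f)).sub (hlim f)
    exact sub_eq_zero.1 (tendsto_nhds_unique h2 h1)
  have hconv : Tendsto ν atTop (𝓝 π) := by
    rw [tendsto_iff_forall_lipschitz_integral_tendsto]
    rintro f hfb ⟨L, hfL⟩
    let F : E →ᵇ ℝ := ⟨⟨f, hfL.continuous⟩, hfb⟩
    change Tendsto (fun k ↦ ∫ y, F y ∂(ν k : Measure E)) atTop (𝓝 (∫ y, F y ∂(π : Measure E)))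
    simp_rw [hν]
    refine (tendsto_add_atTop_iff_nat (f := fun k ↦ cesaroOp P k F x) 1).2 ?_
    refine Metric.tendsto_nhds.2 fun ε hε ↦ ?_
    obtain ⟨k, hk⟩ := (ProbabilityMeasure.eventually_abs_integral_sub_le hπ L ‖F‖
      (half_pos hε)).exists
    have hsub := heval (tendsto_cesaroOp_cesaroOp_sub hPn (φ k).succ_ne_zero F)
    filter_upwards [Metric.tendsto_nhds.1 hsub _ (half_pos hε), eventually_ne_atTop 0]
      with m hm hm0
    have h1 := hk (cesaroOp P m F) (lipschitzWith_cesaroOp hfL m) (norm_cesaroOp_apply_le hPn m F)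
    rw [Function.comp_apply, hν, cesaroOp_commute,
      integral_cesaroOp_of_invariant hT hΦ hinv hm0] at h1
    rw [dist_zero_right, Real.norm_eq_abs, BoundedContinuousFunction.sub_apply] at hm
    rw [Real.dist_eq]
    have := abs_sub_le (cesaroOp P m F x) (cesaroOp P m (cesaroOp P (φ k + 1) F) x)
      (∫ y, F y ∂(π : Measure E))
    rw [abs_sub_comm] at hm
    linarith
  refine ⟨π, inferInstance, hinv, fun f ↦ ?_⟩
  refine (tendsto_add_atTop_iff_nat (f := fun k ↦ cesaroOp P k f x) 1).1 ?_
  simpa only [hν] using ProbabilityMeasure.tendsto_iff_forall_integral_tendsto.1 hconv f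

end MarkovOperator

/-- convergence of Cesàro averages in ℝⁿ: each `T i` nonexpansive and
the Markov operator `𝒫` has an invariant probability measure.  Then (a) for every
`x ∈ Supp μ` the Cesàro averages of `(δ_x𝒫ʲ)` converge in distribution to an invariant
probability measure `π^x`, and (b) the Cesàro averages of `(μ𝒫ʲ)` converge in
distribution to an invariant probability measure `π^μ` with
`π^μ(A) = ∫_{Supp μ} π^x(A) μ(dx)` for all Borel `A`. -/
theorem stmt9
    {n : ℕ} {I : Type*} [MeasurableSpace I]
    (T : I → EuclideanSpace ℝ (Fin n) → EuclideanSpace ℝ (Fin n))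
    (hT : ∀ i x y, ‖T i x - T i y‖ ≤ ‖x - y‖)
    (hΦ : Measurable fun p : EuclideanSpace ℝ (Fin n) × I => T p.2 p.1)
    (μξ : Measure I) [IsProbabilityMeasure μξ]
    (hinv : ∃ π : Measure (EuclideanSpace ℝ (Fin n)),
      IsProbabilityMeasure π ∧ markovStep μξ T π = π)
    (μ : Measure (EuclideanSpace ℝ (Fin n))) [IsProbabilityMeasure μ] :
    ∃ πx : EuclideanSpace ℝ (Fin n) → Measure (EuclideanSpace ℝ (Fin n)),
      (∀ x ∈ msupport μ,
        IsProbabilityMeasure (πx x) ∧ markovStep μξ T (πx x) = πx x ∧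
        ∀ f : BoundedContinuousFunction (EuclideanSpace ℝ (Fin n)) ℝ,
          Tendsto (fun k => ∫ y, f y ∂(cesaro μξ T (MeasureTheory.Measure.dirac x) k))
            atTop (nhds (∫ y, f y ∂(πx x)))) ∧
      ∃ πμ : Measure (EuclideanSpace ℝ (Fin n)),
        IsProbabilityMeasure πμ ∧ markovStep μξ T πμ = πμ ∧
        (∀ f : BoundedContinuousFunction (EuclideanSpace ℝ (Fin n)) ℝ,
          Tendsto (fun k => ∫ y, f y ∂(cesaro μξ T μ k)) atTop (nhds (∫ y, f y ∂πμ))) ∧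
        ∀ A : Set (EuclideanSpace ℝ (Fin n)), MeasurableSet A →
          πμ A = ∫⁻ x in msupport μ, πx x A ∂μ := by
  have hT' (i : I) : LipschitzWith 1 (T i) :=
    LipschitzWith.of_dist_le_mul fun x y ↦ by simpa [dist_eq_norm] using hT i x y
  obtain ⟨ρ, hρ, hρinv⟩ := hinv
  choose πx hprob hπinv hlim using exists_invariant_tendsto_cesaroOp hT' hΦ hρinv
  have hmeas : Measurable πx := measurable_of_forall_measurable_integral hprob fun f ↦
    measurable_of_tendsto_metrizable
      (fun k ↦ (cesaroOp (markovOp hT' hΦ μξ) k f).continuous.measurable)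
      (tendsto_pi_nhds.2 fun x ↦ hlim x f)
  refine ⟨πx, fun x _ ↦ ⟨hprob x, hπinv x, fun f ↦ ?_⟩, μ.bind πx,
    isProbabilityMeasure_bind μ hmeas hprob, ?_, fun f ↦ ?_, fun A hA ↦ ?_⟩
  · simpa only [integral_cesaro_dirac hT' hΦ] using hlim x f
  · rw [markovStep, Measure.bind_bind hmeas.aemeasurable (measurable_map_apply hΦ).aemeasurable]
    exact congrArg μ.bind (funext hπinv)
  · rw [integral_bind_of_measurable μ hmeas hprob]
    simp_rw [integral_cesaro hT' hΦ]
    refine tendsto_integral_of_dominated_convergence (fun _ ↦ ‖f‖)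
      (fun k ↦ (BoundedContinuousFunction.integrable μ _).aestronglyMeasurable)
      (integrable_const _) (fun k ↦ ae_of_all _ fun x ↦ ?_) (ae_of_all _ fun x ↦ hlim x f)
    exact (BoundedContinuousFunction.norm_coe_le_norm _ x).trans
      (norm_cesaroOp_apply_le norm_markovOp_apply_le k f)
  · rw [Measure.bind_apply hA hmeas.aemeasurable, msupport_eq_support,
      Measure.restrict_eq_self_of_ae_mem (s := μ.support) Measure.support_mem_ae]
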